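/- Let n ≥ 1 and let w be a permutation of {1,…,2n}. In ℤ[Y₁,…,Y_n] set P_w := ∏_{1≤i<j≤n} (ρ(w(i)) + ρ(w(j)))·(ρ(w(i)) + ρ(w(2n+1−j))). Then: if w is signed, P_w = (−1)^{inv(|w|)} · ∏_{1≤i<j≤n} (Y_i + Y_j)(Y_i − Y_j); and if w is not signed, P_w = 0. -/

import Mathlib

/-!
Statement 4: restriction property of the polynomial representing the equivariant class
of the closed `Sp(2n)`-orbit.  We work 0-indexed: positions `0,…,2n−1` correspond to
`1,…,2n`; the 1-based `2n+1−i` is position `2n−1−i`.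
-/

/-- The variable `Y_k` of `ℤ[Y₁,…,Yₙ]` (0-indexed), or `0` if `k` is out of range. -/
noncomputable def Yv (n : ℕ) (k : ℕ) : MvPolynomial (Fin n) ℤ :=
  if h : k < n then MvPolynomial.X ⟨k, h⟩ else 0

/-- `ρ` in the even case (0-indexed): `ρ(k) = Y_k` for `k < n`, `ρ(k) = −Y_{2n−1−k}`
for `k ≥ n`. -/
noncomputable def rhoEven (n : ℕ) (k : ℕ) : MvPolynomial (Fin n) ℤ :=
  if k < n then Yv n k else - Yv n (2 * n - 1 - k)

/-- `w` is a signed permutation: `w(2n+1−i) = 2n+1−w(i)` for all `i`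
(0-indexed: `w(2n−1−k) = 2n−1−w(k)`). -/
def SignedEven (n : ℕ) (w : Equiv.Perm (Fin (2 * n))) : Prop :=
  ∀ k : Fin (2 * n), ((w ⟨2 * n - 1 - (k : ℕ), by omega⟩ : Fin (2 * n)) : ℕ)
    = 2 * n - 1 - ((w k : Fin (2 * n)) : ℕ)

/-- The "absolute value" `|w|(i)`: `w(i)` if `w(i) ≤ n` (1-based), else `2n+1−w(i)`. -/
def absEven (n : ℕ) (w : Equiv.Perm (Fin (2 * n))) (i : Fin n) : ℕ :=
  if ((w ⟨(i : ℕ), by omega⟩ : Fin (2 * n)) : ℕ) < n then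
    ((w ⟨(i : ℕ), by omega⟩ : Fin (2 * n)) : ℕ)
  else 2 * n - 1 - ((w ⟨(i : ℕ), by omega⟩ : Fin (2 * n)) : ℕ)

/-- The number of inversions of `|w|`: pairs `i < j` with `|w|(i) > |w|(j)`. -/
def invEven (n : ℕ) (w : Equiv.Perm (Fin (2 * n))) : ℕ :=
  (Finset.univ.filter fun p : Fin n × Fin n =>
    p.1 < p.2 ∧ absEven n w p.2 < absEven n w p.1).card

/-- `∏_{1≤i<j≤n} (ρ(w(i))+ρ(w(j)))·(ρ(w(i))+ρ(w(2n+1−j)))`. -/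
noncomputable def pairProdEven (n : ℕ) (w : Equiv.Perm (Fin (2 * n))) :
    MvPolynomial (Fin n) ℤ :=
  ∏ p ∈ Finset.univ.filter (fun p : Fin n × Fin n => p.1 < p.2),
    (rhoEven n ((w ⟨(p.1 : ℕ), by omega⟩ : Fin (2 * n)) : ℕ) +
        rhoEven n ((w ⟨(p.2 : ℕ), by omega⟩ : Fin (2 * n)) : ℕ)) *
    (rhoEven n ((w ⟨(p.1 : ℕ), by omega⟩ : Fin (2 * n)) : ℕ) +
        rhoEven n ((w ⟨2 * n - 1 - (p.2 : ℕ), by omega⟩ : Fin (2 * n)) : ℕ))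

/-- Permuting the variables of an antisymmetric product over pairs `i < j` produces the
sign `(-1) ^ inv σ`. -/
theorem prod_pairs_comp_perm {R : Type*} [CommRing R] {n : ℕ} (σ : Equiv.Perm (Fin n))
    (h : Fin n → Fin n → R) (hanti : ∀ a b, h b a = -h a b) :
    ∏ p ∈ Finset.univ.filter (fun p : Fin n × Fin n => p.1 < p.2), h (σ p.1) (σ p.2) =
      (-1) ^ (Finset.univ.filter fun p : Fin n × Fin n => p.1 < p.2 ∧ σ p.2 < σ p.1).card *
        ∏ p ∈ Finset.univ.filter (fun p : Fin n × Fin n => p.1 < p.2), h p.1 p.2 := by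
  have hsort : ∏ p ∈ Finset.univ.filter (fun p : Fin n × Fin n => p.1 < p.2),
      h (min (σ p.1) (σ p.2)) (max (σ p.1) (σ p.2)) =
      ∏ p ∈ Finset.univ.filter (fun p : Fin n × Fin n => p.1 < p.2), h p.1 p.2 := by
    have hmaps : ∀ τ : Equiv.Perm (Fin n), ∀ p : Fin n × Fin n, p.1 < p.2 →
        min (τ p.1) (τ p.2) < max (τ p.1) (τ p.2) := fun τ p hp =>
      min_lt_max.2 fun he => hp.ne (τ.injective he)
    have hinv : ∀ τ : Equiv.Perm (Fin n), ∀ p : Fin n × Fin n, p.1 < p.2 →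
        (min (τ.symm (min (τ p.1) (τ p.2))) (τ.symm (max (τ p.1) (τ p.2))),
          max (τ.symm (min (τ p.1) (τ p.2))) (τ.symm (max (τ p.1) (τ p.2)))) = p := by
      intro τ p hp
      rcases le_total (τ p.1) (τ p.2) with hle | hle <;>
        simp [hle, min_eq_left hp.le, max_eq_right hp.le, min_eq_right hp.le,
          max_eq_left hp.le]
    refine Finset.prod_nbij' (fun p => (min (σ p.1) (σ p.2), max (σ p.1) (σ p.2)))
      (fun p => (min (σ.symm p.1) (σ.symm p.2), max (σ.symm p.1) (σ.symm p.2)))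
      ?_ ?_ ?_ ?_ ?_
    · intro p hp
      simpa using hmaps σ p (Finset.mem_filter.1 hp).2
    · intro p hp
      simpa using hmaps σ.symm p (Finset.mem_filter.1 hp).2
    · exact fun p hp => hinv σ p (Finset.mem_filter.1 hp).2
    · exact fun p hp => hinv σ.symm p (Finset.mem_filter.1 hp).2
    · exact fun p _ => rfl
  have hsign : ((-1 : R)) ^
      (Finset.univ.filter fun p : Fin n × Fin n => p.1 < p.2 ∧ σ p.2 < σ p.1).card =
      ∏ p ∈ Finset.univ.filter (fun p : Fin n × Fin n => p.1 < p.2),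
        if σ p.2 < σ p.1 then -1 else 1 := by
    rw [Finset.prod_ite, Finset.prod_const, Finset.prod_const_one, mul_one,
      Finset.filter_filter]
  rw [← hsort, hsign, ← Finset.prod_mul_distrib]
  refine Finset.prod_congr rfl fun p _ => ?_
  split_ifs with hlt
  · rw [min_eq_right hlt.le, max_eq_left hlt.le, hanti (σ p.2) (σ p.1)]
    ring
  · rw [min_eq_left (not_lt.1 hlt), max_eq_right (not_lt.1 hlt), one_mul]

/-- `ρ` is odd under `k ↦ 2n−1−k`. -/
theorem rhoEven_reflect {n k : ℕ} (hk : k < 2 * n) :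
    rhoEven n (2 * n - 1 - k) = -rhoEven n k := by
  unfold rhoEven
  have hkk : 2 * n - 1 - (2 * n - 1 - k) = k := by omega
  by_cases h : k < n
  · rw [if_pos h, if_neg (by omega), hkk]
  · rw [if_neg h, if_pos (by omega), neg_neg]

theorem absEven_lt {n : ℕ} (w : Equiv.Perm (Fin (2 * n))) (i : Fin n) :
    absEven n w i < n := by
  unfold absEven
  split_ifs <;> omega

theorem rhoEven_sq {n : ℕ} (w : Equiv.Perm (Fin (2 * n))) (i : Fin n) :
    rhoEven n (w ⟨(i : ℕ), by omega⟩ : Fin (2 * n)) ^ 2 =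
      (MvPolynomial.X ⟨absEven n w i, absEven_lt w i⟩ : MvPolynomial (Fin n) ℤ) ^ 2 := by
  have hX : (MvPolynomial.X ⟨absEven n w i, absEven_lt w i⟩ : MvPolynomial (Fin n) ℤ) =
      Yv n (absEven n w i) := by
    rw [Yv, dif_pos (absEven_lt w i)]
  rw [hX]
  unfold rhoEven absEven
  split_ifs
  · rfl
  · rw [neg_sq]

theorem absEven_injective {n : ℕ} {w : Equiv.Perm (Fin (2 * n))} (hw : SignedEven n w) :
    Function.Injective (absEven n w) := by
  intro i j hij
  have hcases : ((w ⟨(i : ℕ), by omega⟩ : Fin (2 * n)) : ℕ) =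
        ((w ⟨(j : ℕ), by omega⟩ : Fin (2 * n)) : ℕ) ∨
      ((w ⟨(i : ℕ), by omega⟩ : Fin (2 * n)) : ℕ) =
        2 * n - 1 - ((w ⟨(j : ℕ), by omega⟩ : Fin (2 * n)) : ℕ) := by
    unfold absEven at hij
    split_ifs at hij <;> omega
  rcases hcases with h | h
  · have := congrArg Fin.val (w.injective (Fin.ext h))
    exact Fin.ext this
  · rw [← hw ⟨(j : ℕ), by omega⟩] at h
    have := congrArg Fin.val (w.injective (Fin.ext h))
    simp only at this
    omega

/-- The permutation `|w|` of a signed permutation `w`. -/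
noncomputable def absPerm {n : ℕ} {w : Equiv.Perm (Fin (2 * n))} (hw : SignedEven n w) :
    Equiv.Perm (Fin n) :=
  Equiv.ofBijective (fun i => ⟨absEven n w i, absEven_lt w i⟩)
    (Finite.injective_iff_bijective.1 fun _ _ h => absEven_injective hw (congrArg Fin.val h))

theorem pairProdEven_of_signed {n : ℕ} {w : Equiv.Perm (Fin (2 * n))}
    (hw : SignedEven n w) :
    pairProdEven n w = ((-1) ^ invEven n w : MvPolynomial (Fin n) ℤ) *
      ∏ p ∈ Finset.univ.filter (fun p : Fin n × Fin n => p.1 < p.2),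
        (MvPolynomial.X p.1 + MvPolynomial.X p.2) *
          (MvPolynomial.X p.1 - MvPolynomial.X p.2) := by
  have key := prod_pairs_comp_perm (absPerm hw)
    (fun a b => ((MvPolynomial.X a + MvPolynomial.X b) *
      (MvPolynomial.X a - MvPolynomial.X b) : MvPolynomial (Fin n) ℤ))
    (fun a b => by ring)
  have hinv : invEven n w = (Finset.univ.filter fun p : Fin n × Fin n =>
      p.1 < p.2 ∧ absPerm hw p.2 < absPerm hw p.1).card := rfl
  rw [hinv, ← key, pairProdEven]
  refine Finset.prod_congr rfl fun p _ => ?_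
  have hj := hw ⟨(p.2 : ℕ), by omega⟩
  simp only at hj
  rw [hj, rhoEven_reflect (Fin.is_lt _)]
  have hsq : ∀ i : Fin n, rhoEven n (w ⟨(i : ℕ), by omega⟩ : Fin (2 * n)) ^ 2 =
      (MvPolynomial.X (absPerm hw i) : MvPolynomial (Fin n) ℤ) ^ 2 := rhoEven_sq w
  linear_combination hsq p.1 - hsq p.2

/-- A permutation that commutes with the reflection on the first half is signed. -/
theorem signedEven_of_forall_lt {n : ℕ} {w : Equiv.Perm (Fin (2 * n))}
    (h : ∀ i : Fin n, ((w ⟨2 * n - 1 - (i : ℕ), by omega⟩ : Fin (2 * n)) : ℕ) =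
      2 * n - 1 - ((w ⟨(i : ℕ), by omega⟩ : Fin (2 * n)) : ℕ)) : SignedEven n w := by
  intro k
  by_cases hk : (k : ℕ) < n
  · exact h ⟨k, hk⟩
  · have hi := h ⟨2 * n - 1 - k, by omega⟩
    have hkk : (⟨2 * n - 1 - (2 * n - 1 - (k : ℕ)), by omega⟩ : Fin (2 * n)) = k :=
      Fin.ext (by simp only; omega)
    simp only [hkk] at hi
    omega

theorem pairProdEven_of_not_signed {n : ℕ} {w : Equiv.Perm (Fin (2 * n))}
    (hw : ¬ SignedEven n w) : pairProdEven n w = 0 := by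
  have hex : ∃ i : Fin n, ((w ⟨2 * n - 1 - (i : ℕ), by omega⟩ : Fin (2 * n)) : ℕ) ≠
      2 * n - 1 - ((w ⟨(i : ℕ), by omega⟩ : Fin (2 * n)) : ℕ) := by
    by_contra! hall
    exact hw (signedEven_of_forall_lt hall)
  obtain ⟨i, hi, hmin⟩ := WellFounded.has_min wellFounded_lt
    {i : Fin n | ((w ⟨2 * n - 1 - (i : ℕ), by omega⟩ : Fin (2 * n)) : ℕ) ≠
      2 * n - 1 - ((w ⟨(i : ℕ), by omega⟩ : Fin (2 * n)) : ℕ)} hex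
  simp only [Set.mem_ofPred_eq] at hi hmin
  have hcomm : ∀ j : Fin n, j < i →
      ((w ⟨2 * n - 1 - (j : ℕ), by omega⟩ : Fin (2 * n)) : ℕ) =
        2 * n - 1 - ((w ⟨(j : ℕ), by omega⟩ : Fin (2 * n)) : ℕ) := fun j hj => by
    by_contra hne
    exact hmin j hne hj
  obtain ⟨p, hp⟩ := w.surjective
    ⟨2 * n - 1 - ((w ⟨(i : ℕ), by omega⟩ : Fin (2 * n)) : ℕ), by omega⟩
  have hpv := congrArg Fin.val hp
  simp only at hpv
  by_cases hpn : (p : ℕ) < n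
  · have hlt : i < (⟨p, hpn⟩ : Fin n) := by
      rcases lt_trichotomy i ⟨p, hpn⟩ with h | h | h
      · exact h
      · exfalso
        subst h
        simp only [Fin.eta] at hpv
        omega
      · exfalso
        have hc := hcomm _ h
        simp only [Fin.eta] at hc
        have heq := congrArg Fin.val (w.injective (a₁ := ⟨2 * n - 1 - (p : ℕ), by omega⟩)
          (a₂ := ⟨(i : ℕ), by omega⟩) (Fin.ext (by omega)))
        simp only at heq
        omega
    refine Finset.prod_eq_zero (i := (i, ⟨p, hpn⟩)) (by simpa using hlt) ?_
    simp only [Fin.eta, hpv]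
    rw [rhoEven_reflect (Fin.is_lt _)]
    ring
  · have hj : 2 * n - 1 - (p : ℕ) < n := by omega
    have hpp : (⟨2 * n - 1 - (2 * n - 1 - (p : ℕ)), by omega⟩ : Fin (2 * n)) = p :=
      Fin.ext (by simp only; omega)
    have hlt : i < (⟨2 * n - 1 - (p : ℕ), hj⟩ : Fin n) := by
      rcases lt_trichotomy i ⟨2 * n - 1 - (p : ℕ), hj⟩ with h | h | h
      · exact h
      · exfalso
        apply hi
        have : (⟨2 * n - 1 - (i : ℕ), by omega⟩ : Fin (2 * n)) = p :=
          Fin.ext (by rw [Fin.ext_iff] at h; simp only at h ⊢; omega)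
        rw [this, hpv]
      · exfalso
        have hc := hcomm _ h
        simp only [hpp] at hc
        have heq := congrArg Fin.val (w.injective (a₁ := ⟨2 * n - 1 - (p : ℕ), by omega⟩)
          (a₂ := ⟨(i : ℕ), by omega⟩) (Fin.ext (by omega)))
        rw [Fin.lt_def] at h
        simp only at heq h
        omega
    refine Finset.prod_eq_zero (i := (i, ⟨2 * n - 1 - (p : ℕ), hj⟩)) (by simpa using hlt) ?_
    simp only [hpp, hpv]
    rw [rhoEven_reflect (Fin.is_lt _)]
    ring

theorem stmt4 (n : ℕ) (hn : 1 ≤ n) (w : Equiv.Perm (Fin (2 * n))) :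
    (SignedEven n w →
      pairProdEven n w = ((-1) ^ invEven n w : MvPolynomial (Fin n) ℤ) *
        ∏ p ∈ Finset.univ.filter (fun p : Fin n × Fin n => p.1 < p.2),
          (MvPolynomial.X p.1 + MvPolynomial.X p.2) *
            (MvPolynomial.X p.1 - MvPolynomial.X p.2)) ∧
    (¬ SignedEven n w → pairProdEven n w = 0) := by
  exact ⟨pairProdEven_of_signed, pairProdEven_of_not_signed⟩
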